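/- arXiv:2012.13781 — 2 statements merged into one kernel-verified Lean document; each statement's English description precedes it below -/
import Mathlib

section
/- Let B be a directed basic finite-dimensional k-algebra, with simple modules {S_i}_{i∈𝒫} and precedence order ⪯ as below. Then (𝒫, ⪯, {S_i}_{i∈𝒫}) is a strict homological system for B: the S_i are pairwise non-isomorphic indecomposable modules, Hom_B(S_i, S_j) ≠ 0 implies i ⪯ j, B admits a filtration with factors among the S_i, the number of isomorphism classes of indecomposable projective B-modules equals |𝒫|, and for every n ≥ 1, Ext^n_B(S_i, S_j) ≠ 0 implies i ⪯ j and i ≠ j (i.e. i ≺ j). -/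
/-!
# Statement 4

For a directed basic finite-dimensional algebra `B`, the simple modules together with
the precedence order form a strict homological system.
-/

open CategoryTheory

noncomputable section

variable (k : Type) [Field k] [IsAlgClosed k]
variable (B : Type) [Ring B] [Algebra k B] [FiniteDimensional k B]

/-- `Ext^n_B(X, Y)`, as a `k`-module. -/
noncomputable abbrev extGrp (n : ℕ) (X Y : ModuleCat B) : ModuleCat k :=
  ((Ext k (ModuleCat B) n).obj (Opposite.op X)).obj Y

/-- Nonvanishing of `Ext^n_B(X, Y)`. -/
def extNZ (n : ℕ) (X Y : ModuleCat B) : Prop := Nontrivial (extGrp k B n X Y)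

/-- A module is indecomposable. -/
def Indec (M : ModuleCat B) : Prop :=
  Nontrivial M ∧ ∀ N₁ N₂ : Submodule B M, IsCompl N₁ N₂ → N₁ = ⊥ ∨ N₂ = ⊥

variable (ι : Type) [Fintype ι] [DecidableEq ι]

/-- `M` is zero or admits a finite filtration with factors among `{Δ i | ok i}`. -/
def HasFiltBy (Δ : ι → ModuleCat B) (ok : ι → Prop)
    (M : Type) [AddCommGroup M] [Module B M] : Prop :=
  Subsingleton M ∨
    ∃ (t : ℕ) (F : Fin (t + 1) → Submodule B M), Monotone F ∧ F 0 = ⊥ ∧ F (Fin.last t) = ⊤ ∧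
      ∀ r : Fin t, ∃ i : ι, ok i ∧
        Nonempty ((↥(F r.succ) ⧸ Submodule.comap (F r.succ).subtype (F r.castSucc)) ≃ₗ[B] Δ i)

/-- Complete irredundant family of representatives of the indecomposable projectives. -/
def IsCompleteProjFam (P : ι → ModuleCat B) : Prop :=
  (∀ i, Module.Finite B (P i) ∧ Indec B (P i) ∧ Projective (P i)) ∧
  (∀ i j, i ≠ j → IsEmpty (P i ≅ P j)) ∧
  (∀ X : ModuleCat B, Module.Finite B X → Indec B X → Projective X → ∃ i, Nonempty (X ≅ P i))

variable (e : ι → B)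

/-- The indecomposable projective `P i = B⬝(e i)`, as a submodule of `B`. -/
def Pmod (i : ι) : Submodule B B := LinearMap.range (LinearMap.toSpanSingleton B B (e i))

/-- The radical of a module: the intersection of its maximal submodules. -/
def radOf (M : Type) [AddCommGroup M] [Module B M] : Submodule B M := sInf {N | IsCoatom N}

/-- The simple module `S i = P i / rad (P i)`. -/
abbrev Smod (i : ι) := (↥(Pmod B ι e i)) ⧸ (radOf B ↥(Pmod B ι e i))

/-- The simple module `S i`, as an object of `ModuleCat B`. -/
noncomputable abbrev SmodCat (i : ι) : ModuleCat B := ModuleCat.of B (Smod B ι e i)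

/-- The relation `i ≺₀ j` iff `Ext¹_B(S i, S j) ≠ 0`. -/
def prec0 (i j : ι) : Prop := extNZ k B 1 (SmodCat B ι e i) (SmodCat B ι e j)

/-- The strict precedence relation `≺`: the transitive closure of `≺₀`. -/
def prec (i j : ι) : Prop := Relation.TransGen (prec0 k B ι e) i j

/-- The precedence relation `⪯`: the reflexive closure of `≺`. -/
def preceq (i j : ι) : Prop := i = j ∨ prec k B ι e i j

/-- `e` is a complete family of primitive orthogonal idempotents of `B`. -/
structure IsCompletePrimitiveIdem : Prop where
  idem : ∀ i, IsIdempotentElem (e i)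
  orth : ∀ i j, i ≠ j → e i * e j = 0
  sum_eq_one : ∑ i, e i = 1
  ne_zero : ∀ i, e i ≠ 0
  primitive : ∀ (i : ι) (f g : B), IsIdempotentElem f → IsIdempotentElem g →
    f * g = 0 → g * f = 0 → e i = f + g → f = 0 ∨ g = 0


/-! ## Homological preliminaries -/

lemma bridgeExt (X Y : ModuleCat.{0} B) (m : ℕ) :
    extNZ k B (m + 1) X Y ↔ Nontrivial (Abelian.Ext X Y (m + 1)) := by
  have R : ProjectiveResolution X := projectiveResolution X
  have key : Subsingleton (Abelian.Ext X Y (m + 1)) ↔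
      ∀ f : R.complex.X (m + 1) ⟶ Y, R.complex.d (m + 2) (m + 1) ≫ f = 0 →
        ∃ g : R.complex.X m ⟶ Y, R.complex.d (m + 1) m ≫ g = f := by
    constructor
    · intro h f hf
      exact (R.extMk_eq_zero_iff f (m + 2) rfl hf m rfl).1 (Subsingleton.elim _ _)
    · intro h
      refine ⟨fun a b => ?_⟩
      have h0 : ∀ a : Abelian.Ext X Y (m + 1), a = 0 := by
        intro a
        obtain ⟨f, hf, rfl⟩ := R.extMk_surjective a (m + 2) rfl
        exact (R.extMk_eq_zero_iff f (m + 2) rfl hf m rfl).2 (h f hf)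
      rw [h0 a, h0 b]
  have key2 : Subsingleton (extGrp k B (m + 1) X Y) ↔
      ∀ f : R.complex.X (m + 1) ⟶ Y, R.complex.d (m + 2) (m + 1) ≫ f = 0 →
        ∃ g : R.complex.X m ⟶ Y, R.complex.d (m + 1) m ≫ g = f := by
    rw [← ModuleCat.isZero_iff_subsingleton, (R.isoExt (R := k) (m + 1) Y).isZero_iff,
      ← HomologicalComplex.exactAt_iff_isZero_homology,
      HomologicalComplex.exactAt_iff' _ m (m + 1) (m + 2) (by simp) (by simp),
      ShortComplex.moduleCat_exact_iff]
    rfl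
  unfold extNZ
  rw [← not_subsingleton_iff_nontrivial, ← not_subsingleton_iff_nontrivial, key, key2]

lemma shortExact_sub {M : Type} [AddCommGroup M] [Module B M] (N : Submodule B M) :
    (ShortComplex.mk (ModuleCat.ofHom N.subtype) (ModuleCat.ofHom N.mkQ)
      (by ext x; simp) : ShortComplex (ModuleCat.{0} B)).ShortExact := by
  have h1 : Mono (ModuleCat.ofHom N.subtype) :=
    (ModuleCat.mono_iff_injective _).2 N.injective_subtype
  have h2 : Epi (ModuleCat.ofHom N.mkQ) :=
    (ModuleCat.epi_iff_surjective _).2 N.mkQ_surjective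
  refine { exact := ?_, mono_f := h1, epi_g := h2 }
  rw [ShortComplex.moduleCat_exact_iff]
  intro x hx
  exact ⟨⟨x, (Submodule.Quotient.mk_eq_zero N).1 hx⟩, rfl⟩

lemma ext_mid {M : Type} [AddCommGroup M] [Module B M] (N : Submodule B M) (Y : ModuleCat.{0} B)
    (n : ℕ) (h1 : Subsingleton (Abelian.Ext (ModuleCat.of B N) Y n))
    (h2 : Subsingleton (Abelian.Ext (ModuleCat.of B (M ⧸ N)) Y n)) :
    Subsingleton (Abelian.Ext (ModuleCat.of B M) Y n) := by
  have h0 : ∀ a : Abelian.Ext (ModuleCat.of B M) Y n, a = 0 := by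
    intro a
    obtain ⟨b, rfl⟩ := Abelian.Ext.contravariant_sequence_exact₂ (shortExact_sub B N) Y a
      (h1.elim _ _)
    have : b = 0 := h2.elim _ _
    rw [this, Abelian.Ext.comp_zero]
  exact ⟨fun a b => by rw [h0 a, h0 b]⟩

lemma ext_shift {M : Type} [AddCommGroup M] [Module B M] [Module.Projective B M]
    (N : Submodule B M) (Y : ModuleCat.{0} B)
    (n : ℕ) (h1 : Subsingleton (Abelian.Ext (ModuleCat.of B N) Y (n + 1))) :
    Subsingleton (Abelian.Ext (ModuleCat.of B (M ⧸ N)) Y (n + 2)) := by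
  have : Projective (ModuleCat.of B M) := (IsProjective.iff_projective M).1 inferInstance
  have h0 : ∀ a : Abelian.Ext (ModuleCat.of B (M ⧸ N)) Y (n + 2), a = 0 := by
    intro a
    obtain ⟨b, rfl⟩ := Abelian.Ext.contravariant_sequence_exact₃ (shortExact_sub B N) Y a
      (Abelian.Ext.eq_zero_of_projective _) (n₀ := n + 1) (by omega)
    have : b = 0 := h1.elim _ _
    rw [this, Abelian.Ext.comp_zero]
  exact ⟨fun a b => by rw [h0 a, h0 b]⟩

lemma ext_one_extend {M : Type} [AddCommGroup M] [Module B M]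
    (N : Submodule B M) (Y : Type) [AddCommGroup Y] [Module B Y]
    (h1 : Subsingleton (Abelian.Ext (ModuleCat.of B (M ⧸ N)) (ModuleCat.of B Y) 1))
    (f : N →ₗ[B] Y) : ∃ g : M →ₗ[B] Y, ∀ x : N, g x = f x := by
  obtain ⟨b, hb⟩ := Abelian.Ext.contravariant_sequence_exact₁ (shortExact_sub B N)
    (Y := ModuleCat.of B Y) (Abelian.Ext.mk₀ (ModuleCat.ofHom f)) (n₁ := 1) (by omega)
      (h1.elim _ _)
  obtain ⟨g, rfl⟩ := (Abelian.Ext.mk₀_bijective _ _).2 b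
  rw [Abelian.Ext.mk₀_comp_mk₀] at hb
  have := (Abelian.Ext.mk₀_bijective _ _).1 hb
  exact ⟨g.hom, fun x => ConcreteCategory.congr_hom this x⟩

lemma ext_congr {M N : Type} [AddCommGroup M] [Module B M] [AddCommGroup N] [Module B N]
    (u : M ≃ₗ[B] N) (Y : ModuleCat.{0} B) (n : ℕ)
    (h : Subsingleton (Abelian.Ext (ModuleCat.of B M) Y n)) :
    Subsingleton (Abelian.Ext (ModuleCat.of B N) Y n) := by
  have h0 : ∀ a : Abelian.Ext (ModuleCat.of B N) Y n, a = 0 := by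
    intro a
    have e1 : (Abelian.Ext.mk₀ (ModuleCat.ofHom u.toLinearMap)).comp a (zero_add n) = 0 :=
      h.elim _ _
    have e2 : (Abelian.Ext.mk₀ (ModuleCat.ofHom u.symm.toLinearMap)).comp
      ((Abelian.Ext.mk₀ (ModuleCat.ofHom u.toLinearMap)).comp a (zero_add n)) (zero_add n) = a := by
      rw [Abelian.Ext.mk₀_comp_mk₀_assoc, ← ModuleCat.ofHom_comp]
      simp
    rw [← e2, e1, Abelian.Ext.comp_zero]
  exact ⟨fun a b => by rw [h0 a, h0 b]⟩

/-! ## Indecomposable projectives -/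

lemma fitting_dich {M : Type*} [AddCommGroup M] [Module B M] [IsNoetherian B M] [IsArtinian B M]
    (hM : ∀ N₁ N₂ : Submodule B M, IsCompl N₁ N₂ → N₁ = ⊥ ∨ N₂ = ⊥) (f : Module.End B M) :
    Function.Surjective f ∨ ∃ n : ℕ, f ^ n = 0 := by
  obtain ⟨n, hn⟩ := Filter.eventually_atTop.1 f.eventually_isCompl_ker_pow_range_pow
  have h := hn (n + 1) (by omega)
  rcases hM _ _ h with h1 | h1
  · left
    rw [h1] at h
    have h2 : LinearMap.range (f ^ (n + 1)) = ⊤ := by simpa using h.codisjoint.eq_top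
    rw [pow_succ'] at h2
    exact Function.Surjective.of_comp (f := f) (g := (f ^ n : Module.End B M))
      (LinearMap.range_eq_top.1 h2)
  · right
    exact ⟨n + 1, LinearMap.range_eq_bot.1 h1⟩

lemma local_of_indec {X S : Type*} [AddCommGroup X] [Module B X] [IsNoetherian B X]
    [IsArtinian B X] [Module.Projective B X] [AddCommGroup S] [Module B S] [IsSimpleModule B S]
    (hX : ∀ N₁ N₂ : Submodule B X, IsCompl N₁ N₂ → N₁ = ⊥ ∨ N₂ = ⊥)
    (p : X →ₗ[B] S) (hp : p ≠ 0) (N : Submodule B X) (hN : ¬ N ≤ LinearMap.ker p) : N = ⊤ := by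
  have hs : Function.Surjective (p ∘ₗ N.subtype) := by
    apply LinearMap.surjective_of_ne_zero
    intro h
    exact hN fun x hx => by simpa using LinearMap.congr_fun h ⟨x, hx⟩
  obtain ⟨f, hf⟩ := Module.projective_lifting_property (p ∘ₗ N.subtype) p hs
  have hf' : ∀ x, p (f x) = p x := fun x => LinearMap.congr_fun hf x
  let F : Module.End B X := N.subtype ∘ₗ f
  rcases fitting_dich B hX F with h | ⟨n, hn⟩
  · rw [eq_top_iff]
    intro x _
    obtain ⟨y, rfl⟩ := h x
    exact (f y).2
  · exfalso
    apply hp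
    ext x
    have : ∀ n : ℕ, ∀ x, p ((F ^ n) x) = p x := by
      intro n
      induction n with
      | zero => intro x; simp
      | succ n ih =>
        intro x
        rw [pow_succ, Module.End.mul_apply, ih]
        exact hf' x
    rw [← this n x, hn]
    simp

lemma surj_of_lift {X Y S : Type*} [AddCommGroup X] [Module B X]
    [Module.Projective B X] [AddCommGroup Y] [Module B Y] [IsNoetherian B Y]
    [IsArtinian B Y] [Module.Projective B Y] [AddCommGroup S] [Module B S] [IsSimpleModule B S]
    (hY : ∀ N₁ N₂ : Submodule B Y, IsCompl N₁ N₂ → N₁ = ⊥ ∨ N₂ = ⊥)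
    (p : X →ₗ[B] S) (hp : p ≠ 0) (q : Y →ₗ[B] S) (hq : q ≠ 0) :
    ∃ f : X →ₗ[B] Y, Function.Surjective f := by
  obtain ⟨f, hf⟩ := Module.projective_lifting_property q p (LinearMap.surjective_of_ne_zero hq)
  refine ⟨f, LinearMap.range_eq_top.1 (local_of_indec B hY q hq _ ?_)⟩
  intro h
  apply hp
  ext x
  rw [← hf]
  exact h ⟨x, rfl⟩

lemma iso_of_top {X Y S : Type*} [AddCommGroup X] [Module B X] [IsNoetherian B X]
    [IsArtinian B X]
    [Module.Projective B X] [AddCommGroup Y] [Module B Y] [IsNoetherian B Y]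
    [IsArtinian B Y] [Module.Projective B Y] [AddCommGroup S] [Module B S] [IsSimpleModule B S]
    (hX : ∀ N₁ N₂ : Submodule B X, IsCompl N₁ N₂ → N₁ = ⊥ ∨ N₂ = ⊥)
    (hY : ∀ N₁ N₂ : Submodule B Y, IsCompl N₁ N₂ → N₁ = ⊥ ∨ N₂ = ⊥)
    (p : X →ₗ[B] S) (hp : p ≠ 0) (q : Y →ₗ[B] S) (hq : q ≠ 0) :
    Nonempty (X ≃ₗ[B] Y) := by
  obtain ⟨f, hf⟩ := surj_of_lift B hY p hp q hq
  obtain ⟨g, hg⟩ := surj_of_lift B hX q hq p hp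
  have h : Function.Injective (g ∘ₗ f) :=
    IsNoetherian.injective_of_surjective_endomorphism (g ∘ₗ f) (hg.comp hf)
  exact ⟨LinearEquiv.ofBijective f ⟨Function.Injective.of_comp (f := g) h, hf⟩⟩

/-! ## The modules `P i` and `S i` -/

section PS

variable {B ι e}

lemma e_mem (i : ι) : e i ∈ Pmod B ι e i := ⟨1, by simp⟩

lemma P_mul (hI : IsCompletePrimitiveIdem B ι e) (i : ι) (x : B) (hx : x ∈ Pmod B ι e i) :
    x * e i = x := by
  obtain ⟨b, rfl⟩ := hx
  have := hI.idem i
  simp [mul_assoc, this.eq]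

lemma P_proj (hI : IsCompletePrimitiveIdem B ι e) (i : ι) :
    Module.Projective B (Pmod B ι e i) := by
  refine Module.Projective.of_split (Pmod B ι e i).subtype
    (LinearMap.toSpanSingleton B B (e i)).rangeRestrict ?_
  ext x
  exact P_mul hI i x.1 x.2

lemma P_indec (hI : IsCompletePrimitiveIdem B ι e) (i : ι) :
    ∀ N₁ N₂ : Submodule B (Pmod B ι e i), IsCompl N₁ N₂ → N₁ = ⊥ ∨ N₂ = ⊥ := by
  intro N₁ N₂ h
  have hm : (⟨e i, e_mem i⟩ : Pmod B ι e i) ∈ N₁ ⊔ N₂ := by rw [h.sup_eq_top]; trivial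
  obtain ⟨a, ha, b, hb, hab⟩ := Submodule.mem_sup.1 hm
  have hab' : a.1 + b.1 = e i := congrArg Subtype.val hab
  have huniq : ∀ x ∈ N₁, ∀ y ∈ N₂, x + y = 0 → x = 0 ∧ y = 0 := by
    intro x hx y hy hxy
    have hx2 : x ∈ N₂ := by
      rw [eq_neg_of_add_eq_zero_left hxy]; exact N₂.neg_mem hy
    have : x = 0 := by
      have := h.inf_eq_bot ▸ (Submodule.mem_inf.2 ⟨hx, hx2⟩)
      simpa using this
    subst this
    simpa using hxy
  have hA : a.1 * a.1 + a.1 * b.1 = a.1 := by rw [← mul_add, hab']; exact P_mul hI i _ a.2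
  have hB : b.1 * a.1 + b.1 * b.1 = b.1 := by rw [← mul_add, hab']; exact P_mul hI i _ b.2
  have h1 := huniq (a.1 • a - a) (N₁.sub_mem (N₁.smul_mem _ ha) ha) (a.1 • b) (N₂.smul_mem _ hb)
    (by
      apply Subtype.ext
      simp only [Submodule.coe_add, Submodule.coe_sub, Submodule.coe_smul, smul_eq_mul,
        Submodule.coe_zero]
      rw [sub_add_eq_add_sub, hA, sub_self])
  have h2 := huniq (b.1 • a) (N₁.smul_mem _ ha) (b.1 • b - b) (N₂.sub_mem (N₂.smul_mem _ hb) hb)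
    (by
      apply Subtype.ext
      simp only [Submodule.coe_add, Submodule.coe_sub, Submodule.coe_smul, smul_eq_mul,
        Submodule.coe_zero]
      rw [add_sub, hB, sub_self])
  have gen : ∀ N : Submodule B (Pmod B ι e i),
      (⟨e i, e_mem i⟩ : Pmod B ι e i) ∈ N → N = ⊤ := by
    intro N hN
    rw [eq_top_iff]
    intro x _
    have : x = x.1 • (⟨e i, e_mem i⟩ : Pmod B ι e i) := Subtype.ext (P_mul hI i x.1 x.2).symm
    rw [this]
    exact N.smul_mem _ hN
  rcases hI.primitive i a.1 b.1 (congrArg Subtype.val (sub_eq_zero.1 h1.1))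
    (congrArg Subtype.val (sub_eq_zero.1 h2.2)) (congrArg Subtype.val h1.2)
    (congrArg Subtype.val h2.1) hab'.symm with h0 | h0
  · left
    have : a = 0 := Subtype.ext h0
    rw [this, zero_add] at hab
    have := gen N₂ (hab ▸ hb)
    rw [this] at h
    simpa using h.inf_eq_bot
  · right
    have : b = 0 := Subtype.ext h0
    rw [this, add_zero] at hab
    have := gen N₁ (hab ▸ ha)
    rw [this] at h
    simpa using h.inf_eq_bot

lemma P_nontriv (hI : IsCompletePrimitiveIdem B ι e) (i : ι) : Nontrivial (Pmod B ι e i) :=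
  ⟨⟨⟨e i, e_mem i⟩, 0, fun h => hI.ne_zero i (congrArg Subtype.val h)⟩⟩

/-- evaluation `P i → M`, `x ↦ x • t`. -/
def evalP (i : ι) {M : Type*} [AddCommGroup M] [Module B M] (t : M) : Pmod B ι e i →ₗ[B] M :=
  LinearMap.toSpanSingleton B M t ∘ₗ (Pmod B ι e i).subtype

lemma evalP_ne (i : ι) {M : Type*} [AddCommGroup M] [Module B M] (t : M) (h : e i • t ≠ 0) :
    evalP (e := e) i t ≠ 0 := by
  intro h0
  exact h (LinearMap.congr_fun h0 ⟨e i, e_mem i⟩)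

lemma exists_e (hI : IsCompletePrimitiveIdem B ι e) {M : Type*} [AddCommGroup M] [Module B M]
    (t : M) (ht : t ≠ 0) : ∃ i, e i • t ≠ 0 := by
  by_contra! h
  apply ht
  rw [← one_smul B t, ← hI.sum_eq_one, Finset.sum_smul]
  simp [h]

variable [IsArtinianRing B]

lemma rad_eq_ker (hI : IsCompletePrimitiveIdem B ι e) (i : ι) {T : Type*} [AddCommGroup T]
    [Module B T] [IsSimpleModule B T] (p : Pmod B ι e i →ₗ[B] T) (hp : p ≠ 0) :
    radOf B (Pmod B ι e i) = LinearMap.ker p := by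
  have := P_proj hI i
  have hc : IsCoatom (LinearMap.ker p) :=
    LinearMap.isCoatom_ker_of_surjective (LinearMap.surjective_of_ne_zero hp)
  apply le_antisymm
  · exact sInf_le hc
  · refine le_sInf fun N hN => ?_
    by_contra hle
    have : ¬ N ≤ LinearMap.ker p := by
      intro h
      rcases hN.le_iff.1 h with h' | h'
      · exact hc.1 h'
      · exact hle h'.le
    exact hN.1 (local_of_indec B (P_indec hI i) p hp N this)

lemma S_simple (hI : IsCompletePrimitiveIdem B ι e) (i : ι) : IsSimpleModule B (Smod B ι e i) := by
  have := P_nontriv hI i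
  obtain ⟨N, hN⟩ := IsCoatomic.exists_coatom (α := Submodule B (Pmod B ι e i))
  have : IsSimpleModule B (Pmod B ι e i ⧸ N) := isSimpleModule_iff_isCoatom.2 hN
  have h : radOf B (Pmod B ι e i) = N := by
    rw [rad_eq_ker hI i N.mkQ, Submodule.ker_mkQ]
    intro h
    apply hN.1
    rw [← N.ker_mkQ, h, LinearMap.ker_zero]
  unfold Smod
  rw [h]
  exact this

lemma S_iso (hI : IsCompletePrimitiveIdem B ι e) (i : ι) {T : Type*} [AddCommGroup T]
    [Module B T] [IsSimpleModule B T] (t : T) (ht : e i • t ≠ 0) :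
    Nonempty (Smod B ι e i ≃ₗ[B] T) := by
  have h := evalP_ne i t ht
  generalize evalP (e := e) i t = p at h
  have h2 := rad_eq_ker hI i p h
  have u := p.quotKerEquivOfSurjective (LinearMap.surjective_of_ne_zero h)
  rw [← h2] at u
  exact ⟨u⟩

lemma mkQ_ne (hI : IsCompletePrimitiveIdem B ι e) (i : ι) :
    (radOf B (Pmod B ι e i)).mkQ ≠ 0 := by
  have := S_simple hI i
  intro h
  have hn := IsSimpleModule.nontrivial B (Smod B ι e i)
  obtain ⟨x, hx⟩ := exists_ne (0 : Smod B ι e i)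
  obtain ⟨y, rfl⟩ := Submodule.mkQ_surjective _ x
  exact hx (LinearMap.congr_fun h y)

lemma S_inj (hI : IsCompletePrimitiveIdem B ι e)
    (hBasic : ∀ i j, i ≠ j → IsEmpty ((↥(Pmod B ι e i)) ≃ₗ[B] ↥(Pmod B ι e j))) (i j : ι)
    (u : Smod B ι e i ≃ₗ[B] Smod B ι e j) : i = j := by
  by_contra hij
  have := P_proj hI i
  have := P_proj hI j
  have := S_simple hI j
  have := S_simple hI i
  obtain ⟨v⟩ := iso_of_top B (P_indec hI i) (P_indec hI j)
    (u.toLinearMap ∘ₗ (radOf B (Pmod B ι e i)).mkQ)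
    (by
      intro h
      apply mkQ_ne hI i
      ext x
      have := LinearMap.congr_fun h x
      simpa using this)
    (radOf B (Pmod B ι e j)).mkQ (mkQ_ne hI j)
  exact (hBasic i j hij).false v

lemma ext_filt (hI : IsCompletePrimitiveIdem B ι e) (Y : ModuleCat.{0} B) (n : ℕ)
    (M : Type) [AddCommGroup M] [Module B M] (hM : IsFiniteLength B M)
    (h : ∀ l, (∃ x : M, e l • x ≠ 0) → Subsingleton (Abelian.Ext (SmodCat B ι e l) Y n)) :
    Subsingleton (Abelian.Ext (ModuleCat.of B M) Y n) := by
  induction hM with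
  | @of_subsingleton M _ _ _ =>
    have h0 : ∀ a : Abelian.Ext (ModuleCat.of B M) Y n, a = 0 := by
      intro a
      rw [← Abelian.Ext.mk₀_id_comp a,
        show 𝟙 (ModuleCat.of B M) = 0 by ext x; exact Subsingleton.elim (α := M) _ _,
        Abelian.Ext.mk₀_zero, Abelian.Ext.zero_comp]
    exact ⟨fun a b => by rw [h0 a, h0 b]⟩
  | @of_simple_quotient M _ _ N hs hN ih =>
    apply ext_mid B N Y n
    · apply ih
      rintro l ⟨x, hx⟩
      exact h l ⟨x.1, fun h' => hx (Subtype.ext h')⟩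
    · have := IsSimpleModule.nontrivial B (M ⧸ N)
      obtain ⟨t, ht⟩ := exists_ne (0 : M ⧸ N)
      obtain ⟨l, hl⟩ := exists_e hI t ht
      obtain ⟨u⟩ := S_iso hI l t hl
      apply ext_congr B u
      apply h
      obtain ⟨y, rfl⟩ := Submodule.mkQ_surjective _ t
      refine ⟨y, fun h' => hl ?_⟩
      rw [← map_smul, h', map_zero]

end PS

section Key

variable {k B ι e}

lemma rad_prec [IsArtinianRing B] (hI : IsCompletePrimitiveIdem B ι e)
    (hBasic : ∀ i j, i ≠ j → IsEmpty ((↥(Pmod B ι e i)) ≃ₗ[B] ↥(Pmod B ι e j))) (i l : ι)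
    (x : Pmod B ι e i) (hx : x ∈ radOf B (Pmod B ι e i)) (hl : e l • x ≠ 0) :
    prec k B ι e i l := by
  have hP := P_proj hI i
  set R := radOf B (Pmod B ι e i) with hR
  let 𝒦 : Set (Submodule B (Pmod B ι e i)) :=
    {K | K ≤ R ∧ ∀ l, ∀ x ∈ R, e l • x ∉ K → prec k B ι e i l}
  obtain ⟨K, hK, hmin⟩ := (wellFounded_lt (α := Submodule B (Pmod B ι e i))).has_min 𝒦
    ⟨R, le_rfl, fun l x hx h => (h (R.smul_mem _ hx)).elim⟩
  by_cases hbot : K = ⊥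
  · exact hK.2 l x hx (by rw [hbot]; simpa using hl)
  exfalso
  have : Nontrivial K := Submodule.nontrivial_iff_ne_bot.2 hbot
  obtain ⟨Q, hQ⟩ := IsCoatomic.exists_coatom (α := Submodule B K)
  have hQs : IsSimpleModule B (K ⧸ Q) := isSimpleModule_iff_isCoatom.2 hQ
  have hlt : Q.map K.subtype < K := by
    refine lt_of_le_of_ne (Submodule.map_subtype_le K Q) ?_
    intro h
    apply hQ.1
    rw [eq_top_iff]
    intro y _
    have hy : (y : Pmod B ι e i) ∈ Q.map K.subtype := by rw [h]; exact y.2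
    obtain ⟨z, hz, hzy⟩ := hy
    rwa [← Subtype.ext (a1 := z) (a2 := y) hzy]
  have hnot : ¬ (∀ l, ∀ x ∈ R, e l • x ∉ Q.map K.subtype → prec k B ι e i l) := fun h =>
    hmin _ ⟨hlt.le.trans hK.1, h⟩ hlt
  push Not at hnot
  obtain ⟨m, y, hyR, hyQ, hm⟩ := hnot
  have hyK : e m • y ∈ K := by
    by_contra h
    exact hm (hK.2 m y hyR h)
  have hee : ∀ (m : ι) (y : Pmod B ι e i), e m • e m • y = e m • y := by
    intro m y
    rw [← mul_smul, (hI.idem m).eq]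
  have hne : e m • Q.mkQ ⟨e m • y, hyK⟩ ≠ 0 := by
    intro h
    rw [← map_smul] at h
    apply hyQ
    refine ⟨_, (Submodule.Quotient.mk_eq_zero Q).1 h, hee m y⟩
  obtain ⟨u⟩ := S_iso hI m _ hne
  have hSi := S_simple hI i
  have hSm := S_simple hI m
  have hext : Subsingleton (Abelian.Ext (ModuleCat.of B (Pmod B ι e i ⧸ K))
      (SmodCat B ι e m) 1) := by
    apply ext_filt hI _ _ _ (isFiniteLength_iff_isNoetherian_isArtinian.2
      ⟨inferInstance, inferInstance⟩)
    rintro n ⟨z, hz⟩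
    rw [← not_nontrivial_iff_subsingleton, ← bridgeExt k B]
    intro hne1
    obtain ⟨w, rfl⟩ := Submodule.mkQ_surjective _ z
    by_cases hni : n = i
    · subst hni
      exact hm (Relation.TransGen.single hne1)
    · have hwR : e n • w ∈ R := by
        by_contra hcon
        have h1 : e n • R.mkQ w ≠ 0 := by
          intro h
          rw [← map_smul] at h
          exact hcon ((Submodule.Quotient.mk_eq_zero R).1 h)
        obtain ⟨v⟩ := S_iso (T := Smod B ι e i) hI n _ h1
        exact hni (S_inj hI hBasic n i v)
      have hpn : prec k B ι e i n := by
        apply hK.2 n _ hwR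
        intro h
        rw [hee] at h
        apply hz
        rw [← map_smul]
        exact (Submodule.Quotient.mk_eq_zero K).2 h
      exact hm (Relation.TransGen.tail hpn hne1)
  obtain ⟨g, hg⟩ := ext_one_extend B K (Smod B ι e m) hext (u.symm.toLinearMap ∘ₗ Q.mkQ)
  have hg1 : g (e m • y) ≠ 0 := by
    have := hg ⟨e m • y, hyK⟩
    rw [this]
    intro h
    apply hne
    have h' : Q.mkQ ⟨e m • y, hyK⟩ = 0 := by simpa using h
    rw [h', smul_zero]
  have hg0 : g ≠ 0 := by
    rintro rfl
    exact hg1 rfl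
  have := rad_eq_ker hI i g hg0
  exact hg1 (by
    have h2 := hK.1 hyK
    rw [hR, this] at h2
    exact h2)

lemma ext_prec [IsArtinianRing B] (hI : IsCompletePrimitiveIdem B ι e)
    (hBasic : ∀ i j, i ≠ j → IsEmpty ((↥(Pmod B ι e i)) ≃ₗ[B] ↥(Pmod B ι e j))) (j : ι) (n : ℕ) :
    ∀ i, extNZ k B (n + 1) (SmodCat B ι e i) (SmodCat B ι e j) → prec k B ι e i j := by
  induction n with
  | zero => exact fun i h => Relation.TransGen.single h
  | succ n ih =>
    intro i h
    by_contra hij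
    have hP := P_proj hI i
    rw [bridgeExt k B, ← not_subsingleton_iff_nontrivial] at h
    apply h
    apply ext_shift B
    apply ext_filt hI _ _ _ (isFiniteLength_iff_isNoetherian_isArtinian.2
      ⟨inferInstance, inferInstance⟩)
    rintro l ⟨x, hx⟩
    rw [← not_nontrivial_iff_subsingleton, ← bridgeExt k B]
    intro hne
    have h1 : prec k B ι e i l := rad_prec hI hBasic i l x.1 x.2 (fun h => hx (Subtype.ext h))
    exact hij (h1.trans (ih l hne))

end Key

/-- Let `B` be a basic finite-dimensional `k`-algebra, with complete
family `e` of primitive orthogonal idempotents (basic: the projectives `B (e i)` are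
pairwise non-isomorphic), which is directed: the transitive closure `≺` of the relation
`Ext¹_B(S i, S j) ≠ 0` is irreflexive.  Then `(ι, ⪯, {S i})` is a strict homological
system for `B`: the `S i` are pairwise non-isomorphic finite-dimensional indecomposable
modules, `Hom_B(S i, S j) ≠ 0` implies `i ⪯ j`, `B` admits a filtration with factors
among the `S i`, the number of isomorphism classes of indecomposable projective
`B`-modules is `|ι|`, and `Ext^n_B(S i, S j) ≠ 0` for some `n ≥ 1` implies `i ≺ j`. -/
theorem statement4 (hIdem : IsCompletePrimitiveIdem B ι e)
    (hBasic : ∀ i j, i ≠ j → IsEmpty ((↥(Pmod B ι e i)) ≃ₗ[B] ↥(Pmod B ι e j)))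
    (hDirected : ∀ i, ¬ prec k B ι e i i) :
    (∀ i, Module.Finite B (Smod B ι e i) ∧ Indec B (SmodCat B ι e i)) ∧
    (∀ i j, i ≠ j → IsEmpty ((Smod B ι e i) ≃ₗ[B] (Smod B ι e j))) ∧
    (∀ i j, (∃ f : (Smod B ι e i) →ₗ[B] (Smod B ι e j), f ≠ 0) → preceq k B ι e i j) ∧
    (HasFiltBy B ι (SmodCat B ι e) (fun _ => True) B) ∧
    (∃ P : ι → ModuleCat B, IsCompleteProjFam B ι P) ∧
    (∀ (n : ℕ), 1 ≤ n → ∀ i j,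
      extNZ k B n (SmodCat B ι e i) (SmodCat B ι e j) → prec k B ι e i j) := by
  have hArt : IsArtinianRing B := IsArtinianRing.of_finite k B
  refine ⟨?_, ?_, ?_, ?_, ?_, ?_⟩
  · intro i
    have := S_simple hIdem i
    refine ⟨inferInstance, IsSimpleModule.nontrivial B (Smod B ι e i), fun N₁ N₂ h => ?_⟩
    rcases eq_bot_or_eq_top (α := Submodule B (Smod B ι e i)) N₁ with h1 | h1
    · exact Or.inl h1
    · right
      have := h.inf_eq_bot
      rw [h1] at this
      simpa using this
  · intro i j hij
    exact ⟨fun u => hij (S_inj hIdem hBasic i j u)⟩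
  · rintro i j ⟨f, hf⟩
    have := S_simple hIdem i
    have := S_simple hIdem j
    left
    exact S_inj hIdem hBasic i j
      (LinearEquiv.ofBijective f (LinearMap.bijective_of_ne_zero hf))
  · right
    obtain ⟨s, hs0, hs1⟩ := exists_compositionSeries_of_isNoetherian_isArtinian B B
    refine ⟨s.length, s, s.strictMono.monotone, hs0, hs1, fun r => ?_⟩
    have cov : s r.castSucc ⋖ s r.succ := s.step r
    have hsim := (covBy_iff_quot_is_simple cov.le).mp cov
    have := IsSimpleModule.nontrivial B
      (↥(s r.succ) ⧸ Submodule.comap (s r.succ).subtype (s r.castSucc))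
    obtain ⟨t, ht⟩ := exists_ne
      (0 : ↥(s r.succ) ⧸ Submodule.comap (s r.succ).subtype (s r.castSucc))
    obtain ⟨l, hl⟩ := exists_e hIdem t ht
    obtain ⟨u⟩ := S_iso hIdem l t hl
    exact ⟨l, trivial, ⟨u.symm⟩⟩
  · have hind : ∀ i, ∀ N₁ N₂ : Submodule B (ULift.{u_1} (Pmod B ι e i)), IsCompl N₁ N₂ →
        N₁ = ⊥ ∨ N₂ = ⊥ := by
      intro i N₁ N₂ h
      let o : Submodule B (ULift.{u_1} (Pmod B ι e i)) ≃o Submodule B (Pmod B ι e i) :=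
        Submodule.orderIsoMapComap ULift.moduleEquiv
      have h' := P_indec hIdem i (o N₁) (o N₂) (o.isCompl h)
      simpa using h'
    have hproj : ∀ i, Module.Projective B (ULift.{u_1} (Pmod B ι e i)) := fun i =>
      have := P_proj hIdem i
      Module.Projective.of_equiv ULift.moduleEquiv.symm
    refine ⟨fun i => ModuleCat.of B (ULift (Pmod B ι e i)), ?_, ?_, ?_⟩
    · intro i
      have := P_nontriv hIdem i
      exact ⟨Module.Finite.equiv (ULift.moduleEquiv (R := B) (M := Pmod B ι e i)).symm,
        ⟨inferInstanceAs (Nontrivial (ULift (Pmod B ι e i))), hind i⟩,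
        (IsProjective.iff_projective _).1 (hproj i)⟩
    · intro i j hij
      exact ⟨fun u => (hBasic i j hij).false
        ((ULift.moduleEquiv.symm.trans u.toLinearEquiv).trans ULift.moduleEquiv)⟩
    · intro X hfin hX hpr
      have hX1 := hX.1
      obtain ⟨N, hN⟩ := IsCoatomic.exists_coatom (α := Submodule B X)
      have hsim : IsSimpleModule B (X ⧸ N) := isSimpleModule_iff_isCoatom.2 hN
      have := IsSimpleModule.nontrivial B (X ⧸ N)
      obtain ⟨t, ht⟩ := exists_ne (0 : X ⧸ N)
      obtain ⟨l, hl⟩ := exists_e hIdem t ht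
      have hq : N.mkQ ≠ 0 := by
        intro h
        obtain ⟨y, rfl⟩ := Submodule.mkQ_surjective _ t
        exact ht (LinearMap.congr_fun h y)
      have hXp : Module.Projective B X := ModuleCat.projective_of_module_projective X
      have := P_proj hIdem l
      obtain ⟨v⟩ := iso_of_top B hX.2 (P_indec hIdem l) N.mkQ hq (evalP l t) (evalP_ne l t hl)
      exact ⟨l, ⟨(v.trans ULift.moduleEquiv.symm).toModuleIso⟩⟩
  · intro n hn i j h
    obtain ⟨m, rfl⟩ : ∃ m, n = m + 1 := ⟨n - 1, by omega⟩
    exact ext_prec hIdem hBasic j m i h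

end
end

section
/- Let B be a directed basic finite-dimensional k-algebra with precedence partial order ⪯ on 𝒫. Then for each i ∈ 𝒫 the trace submodule T_i := Σ { Im f : f ∈ Hom_B(P_j, P_i), ¬(j ⪯ i) } equals rad(P_i); hence the i-th standard B-module Δ_i := P_i/T_i associated to the partially ordered set (𝒫, ⪯) is isomorphic to the simple module S_i, and End_B(S_i) ≅ k. -/
/-!
# Statement 5

For a directed basic finite-dimensional algebra `B` with precedence partial order `⪯`,
the trace `T i` of the projectives `P j`, `j ⋠ i`, in `P i` equals `rad (P i)`; hence
the standard module `Δ i = P i / T i` is the simple module `S i`, and `End_B(S i) ≅ k`.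
-/

open CategoryTheory

noncomputable section

variable (k : Type) [Field k] [IsAlgClosed k]
variable (B : Type) [Ring B] [Algebra k B] [FiniteDimensional k B]

variable (ι : Type) [Fintype ι] [DecidableEq ι]
variable (e : ι → B)

/-- The trace submodule `T i ⊆ P i`: the sum of the images of all homomorphisms
`P j → P i` with `j ⋠ i`. -/
def traceSub (i : ι) : Submodule B ↥(Pmod B ι e i) :=
  ⨆ (j : ι) (_ : ¬ preceq k B ι e j i)
    (f : ↥(Pmod B ι e j) →ₗ[B] ↥(Pmod B ι e i)), LinearMap.range f

lemma split_of_ext {k' : Type} [Field k'] {B' : Type} [Ring B'] [Algebra k' B']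
    (S : ShortComplex (ModuleCat.{0} B')) (hS : S.ShortExact)
    (h : ¬ Nontrivial (((Ext k' (ModuleCat.{0} B') 1).obj (Opposite.op S.X₃)).obj S.X₁)) :
    ∃ s : S.X₃ ⟶ S.X₂, s ≫ S.g = 𝟙 _ := by
  rw [not_nontrivial_iff_subsingleton] at h
  let P := ProjectiveResolution.of S.X₃
  have hz := (ModuleCat.isZero_of_subsingleton
    (((Ext k' (ModuleCat.{0} B') 1).obj (Opposite.op S.X₃)).obj S.X₁)).of_iso
    (P.isoExt (R := k') 1 S.X₁).symm
  rw [← HomologicalComplex.exactAt_iff_isZero_homology,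
    HomologicalComplex.exactAt_iff' _ 0 1 2 (by simp) (by simp),
    ShortComplex.moduleCat_exact_iff] at hz
  have := hS.epi_g
  have := hS.mono_f
  have hπ : Epi (P.π.f 0) := inferInstance
  let p : P.complex.X 0 ⟶ S.X₃ := P.π.f 0
  have hdp : P.complex.d 1 0 ≫ p = 0 := P.complex_d_comp_π_f_zero
  let φ : P.complex.X 0 ⟶ S.X₂ := Projective.factorThru p S.g
  have hφ : φ ≫ S.g = p := Projective.factorThru_comp _ _
  let f : P.complex.X 1 ⟶ S.X₁ := hS.exact.lift (P.complex.d 1 0 ≫ φ) (by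
    rw [Category.assoc, hφ, hdp])
  have hf : f ≫ S.f = P.complex.d 1 0 ≫ φ := hS.exact.lift_f _ _
  obtain ⟨g, hg⟩ := hz f (by
    change P.complex.d 2 1 ≫ f = 0
    rw [← cancel_mono S.f, Category.assoc, hf]
    simp)
  change P.complex.X 0 ⟶ S.X₁ at g
  change P.complex.d 1 0 ≫ g = f at hg
  let s : S.X₃ ⟶ S.X₂ := P.exact₀.desc (φ - g ≫ S.f) (by
    change P.complex.d 1 0 ≫ _ = 0
    rw [Preadditive.comp_sub, ← hf, ← hg]; simp)
  have hs : p ≫ s = φ - g ≫ S.f := P.exact₀.g_desc _ _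
  refine ⟨s, ?_⟩
  have : Epi p := hπ
  rw [← cancel_epi p, ← Category.assoc, hs, Preadditive.sub_comp, hφ]
  simp

section Aux

variable {B ι e}

lemma mem_Pmod_iff (hI : IsCompletePrimitiveIdem B ι e) (i : ι) (b : B) :
    b ∈ Pmod B ι e i ↔ b * e i = b := by
  constructor
  · rintro ⟨c, rfl⟩
    simp [mul_assoc, (hI.idem i).eq]
  · intro h
    exact ⟨b, by simpa using h⟩

/-- The generator of `P i`. -/
def gen (hI : IsCompletePrimitiveIdem B ι e) (i : ι) : Pmod B ι e i :=
  ⟨e i, (mem_Pmod_iff hI i _).2 (hI.idem i)⟩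

lemma smul_gen (hI : IsCompletePrimitiveIdem B ι e) (i : ι) (x : Pmod B ι e i) :
    (x : B) • gen hI i = x := by
  ext
  exact (mem_Pmod_iff hI i _).1 x.2

lemma gen_ne_zero (hI : IsCompletePrimitiveIdem B ι e) (i : ι) : gen hI i ≠ 0 := by
  intro h
  exact hI.ne_zero i (congrArg Subtype.val h)

lemma eq_top_of_gen_mem (hI : IsCompletePrimitiveIdem B ι e) (i : ι)
    (N : Submodule B (Pmod B ι e i)) (h : gen hI i ∈ N) : N = ⊤ := by
  rw [Submodule.eq_top_iff']
  intro x
  rw [← smul_gen hI i x]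
  exact N.smul_mem _ h

/-- Right multiplication by `x`. -/
def rmul {i : ι} (j : ι) (x : Pmod B ι e i) : Pmod B ι e j →ₗ[B] Pmod B ι e i :=
  (LinearMap.toSpanSingleton B _ x) ∘ₗ (Pmod B ι e j).subtype

lemma rmul_apply {i : ι} (j : ι) (x : Pmod B ι e i) (b : Pmod B ι e j) :
    rmul j x b = (b : B) • x := rfl

lemma indec (hI : IsCompletePrimitiveIdem B ι e) (i : ι)
    (A C : Submodule B (Pmod B ι e i)) (h : IsCompl A C) : A = ⊤ ∨ C = ⊤ := by
  have hm : gen hI i ∈ A ⊔ C := by rw [h.sup_eq_top]; trivial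
  obtain ⟨a, ha, c, hc, hac⟩ := Submodule.mem_sup.1 hm
  have hd : ∀ y, y ∈ A → y ∈ C → y = 0 := fun y h1 h2 =>
    (Submodule.disjoint_def.1 h.disjoint) y h1 h2
  have key1 : a - (a : B) • a = (a : B) • c := by
    rw [sub_eq_iff_eq_add, add_comm, ← smul_add, hac, smul_gen]
  have key2 : c - (c : B) • c = (c : B) • a := by
    rw [sub_eq_iff_eq_add, ← smul_add, hac, smul_gen]
  have h1 : a - (a : B) • a = 0 :=
    hd _ (A.sub_mem ha (A.smul_mem _ ha)) (key1 ▸ C.smul_mem _ hc)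
  have h2 : c - (c : B) • c = 0 :=
    hd _ (key2 ▸ A.smul_mem _ ha) (C.sub_mem hc (C.smul_mem _ hc))
  have h3 : (a : B) • c = 0 := key1 ▸ h1
  have h4 : (c : B) • a = 0 := key2 ▸ h2
  have := hI.primitive i a c
    (congrArg Subtype.val (sub_eq_zero.1 h1)).symm (congrArg Subtype.val (sub_eq_zero.1 h2)).symm
    (congrArg Subtype.val h3) (congrArg Subtype.val h4) (congrArg Subtype.val hac).symm
  rcases this with h0 | h0
  · right
    have h0 : a = 0 := Subtype.ext h0
    apply eq_top_of_gen_mem hI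
    rw [← hac, h0, zero_add]; exact hc
  · left
    have h0 : c = 0 := Subtype.ext h0
    apply eq_top_of_gen_mem hI
    rw [← hac, h0, add_zero]; exact ha

lemma coatom_unique [IsArtinianRing B] [IsNoetherianRing B]
    (hI : IsCompletePrimitiveIdem B ι e) (i : ι)
    (N M : Submodule B (Pmod B ι e i)) (hN : IsCoatom N) (hM : IsCoatom M) : N = M := by
  by_contra hne
  have hs : N ⊔ M = ⊤ := hN.sup_eq_top_of_ne hM hne
  have hm : gen hI i ∈ N ⊔ M := by rw [hs]; trivial
  obtain ⟨n, hn, m, hm, hnm⟩ := Submodule.mem_sup.1 hm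
  let f : Module.End B (Pmod B ι e i) := rmul i n
  let g : Module.End B (Pmod B ι e i) := rmul i m
  have hfg : f + g = 1 := by
    ext1 b
    change (b : B) • n + (b : B) • m = b
    rw [← smul_add, hnm, smul_gen]
  have hf : ∀ b, f b ∈ N := fun b => N.smul_mem _ hn
  have hg : ∀ b, g b ∈ M := fun b => M.smul_mem _ hm
  obtain ⟨r, hr⟩ := Filter.eventually_atTop.1 f.eventually_isCompl_ker_pow_range_pow
  have hr := hr (r + 1) (by omega)
  rcases indec hI i _ _ hr with h | h
  · have hnil : IsNilpotent f := ⟨r + 1, LinearMap.ker_eq_top.1 h⟩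
    have hu : IsUnit g := by
      have : g = 1 - f := by rw [← hfg]; abel
      rw [this]; exact hnil.isUnit_one_sub
    have hsurj := ((Module.End.isUnit_iff _).1 hu).2
    apply hM.1
    rw [Submodule.eq_top_iff']
    intro x
    obtain ⟨y, rfl⟩ := hsurj x
    exact hg y
  · apply hN.1
    rw [Submodule.eq_top_iff']
    intro x
    have : x ∈ LinearMap.range (f ^ (r + 1)) := by rw [h]; trivial
    obtain ⟨y, rfl⟩ := this
    rw [pow_succ']
    exact hf _

lemma radOf_eq [IsArtinianRing B] [IsNoetherianRing B]
    (hI : IsCompletePrimitiveIdem B ι e) (i : ι)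
    (N : Submodule B (Pmod B ι e i)) (hN : IsCoatom N) : radOf B (Pmod B ι e i) = N := by
  apply le_antisymm
  · exact sInf_le hN
  · exact le_sInf fun M hM => (coatom_unique hI i N M hN hM).le

lemma le_rad [IsArtinianRing B] [IsNoetherianRing B]
    (hI : IsCompletePrimitiveIdem B ι e) (i : ι)
    (N : Submodule B (Pmod B ι e i)) (hN : N ≠ ⊤) : N ≤ radOf B (Pmod B ι e i) := by
  obtain h | ⟨M, hM, hNM⟩ := eq_top_or_exists_le_coatom N
  · exact absurd h hN
  · rw [radOf_eq hI i M hM]; exact hNM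

lemma isCoatom_rad [IsArtinianRing B] [IsNoetherianRing B]
    (hI : IsCompletePrimitiveIdem B ι e) (i : ι) : IsCoatom (radOf B (Pmod B ι e i)) := by
  obtain h | ⟨M, hM, hNM⟩ := eq_top_or_exists_le_coatom (⊥ : Submodule B (Pmod B ι e i))
  · exfalso
    have : gen hI i ∈ (⊥ : Submodule B (Pmod B ι e i)) := by rw [h]; trivial
    exact gen_ne_zero hI i (by simpa using this)
  · rwa [radOf_eq hI i M hM]

lemma range_le_rad [IsArtinianRing B] [IsNoetherianRing B]
    (hI : IsCompletePrimitiveIdem B ι e) (i j : ι)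
    (hB : IsEmpty ((Pmod B ι e j) ≃ₗ[B] Pmod B ι e i))
    (f : Pmod B ι e j →ₗ[B] Pmod B ι e i) :
    LinearMap.range f ≤ radOf B (Pmod B ι e i) := by
  apply le_rad hI
  intro hf
  obtain ⟨y, hy⟩ := LinearMap.range_eq_top.1 hf (gen hI i)
  let s : Pmod B ι e i →ₗ[B] Pmod B ι e j := rmul i y
  have hs : ∀ b, f (s b) = b := by
    intro b
    change f ((b : B) • y) = b
    rw [map_smul, hy, smul_gen]
  have hid : IsIdempotentElem (s ∘ₗ f : Module.End B (Pmod B ι e j)) := by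
    ext1 b
    change s (f (s (f b))) = s (f b)
    rw [hs]
  have hsinj : LinearMap.ker s = ⊥ :=
    LinearMap.ker_eq_bot.2 (Function.LeftInverse.injective hs)
  have hk : LinearMap.ker (s ∘ₗ f) = LinearMap.ker f :=
    LinearMap.ker_comp_of_ker_eq_bot _ hsinj
  rcases indec hI j _ _ (LinearMap.IsIdempotentElem.isCompl hid) with h | h
  · rw [LinearMap.range_eq_top] at h
    have hsb : Function.Surjective s := fun x => by
      obtain ⟨b, hb⟩ := h x
      exact ⟨f b, hb⟩
    exact hB.false (LinearEquiv.ofBijective s ⟨LinearMap.ker_eq_bot.1 hsinj, hsb⟩).symm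
  · rw [hk, LinearMap.ker_eq_top] at h
    apply gen_ne_zero hI i
    rw [← hy, h]; rfl

lemma prec0_of_covBy [IsArtinianRing B] [IsNoetherianRing B]
    (hI : IsCompletePrimitiveIdem B ι e) (i j : ι)
    (N : Submodule B (Pmod B ι e i)) (hN : N ⋖ radOf B (Pmod B ι e i))
    (x : Pmod B ι e i) (hxr : x ∈ radOf B (Pmod B ι e i)) (hxN : e j • x ∉ N) :
    prec0 k B ι e i j := by
  let g : Pmod B ι e j →ₗ[B] (Pmod B ι e i ⧸ N) := N.mkQ ∘ₗ rmul j x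
  have hcov : ∀ K : Submodule B (Pmod B ι e j), ¬ K ≤ LinearMap.ker g →
      N ⊔ K.map (rmul j x) = radOf B (Pmod B ι e i) := by
    intro K hK
    have hle : N ⊔ K.map (rmul j x) ≤ radOf B (Pmod B ι e i) := by
      refine sup_le hN.le ?_
      rintro _ ⟨b, -, rfl⟩
      exact Submodule.smul_mem _ _ hxr
    have hlt : N < N ⊔ K.map (rmul j x) := by
      refine lt_of_le_of_ne le_sup_left fun h => hK fun b hb => ?_
      have : rmul j x b ∈ N := by
        rw [h]; exact Submodule.mem_sup_right (Submodule.mem_map_of_mem hb)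
      rw [LinearMap.mem_ker]
      exact (Submodule.Quotient.mk_eq_zero N).2 this
    exact (hN.eq_or_eq hlt.le hle).resolve_left hlt.ne'
  have hmemker : ∀ b, b ∈ LinearMap.ker g ↔ (b : B) • x ∈ N := fun b => by
    rw [LinearMap.mem_ker]
    exact Submodule.Quotient.mk_eq_zero N
  have hgen : gen hI j ∉ LinearMap.ker g := fun h => hxN ((hmemker _).1 h)
  have hco : IsCoatom (LinearMap.ker g) := by
    refine ⟨fun h => hgen (by rw [h]; trivial), fun K hK => ?_⟩
    have hx : e j • x ∈ N ⊔ K.map (rmul j x) := by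
      rw [hcov K hK.not_ge]; exact Submodule.smul_mem _ _ hxr
    obtain ⟨n, hn, _, ⟨κ, hκ, rfl⟩, hsum⟩ := Submodule.mem_sup.1 hx
    apply eq_top_of_gen_mem hI
    have : gen hI j - κ ∈ LinearMap.ker g := by
      rw [hmemker]
      have h2 : ((gen hI j - κ : Pmod B ι e j) : B) • x = n := by
        change (e j - (κ : B)) • x = n
        rw [sub_smul, ← hsum, rmul_apply]; abel
      rwa [h2]
    have := K.add_mem (hK.le this) hκ
    simpa using this
  have hrad := radOf_eq hI j _ hco
  let f : Smod B ι e j →ₗ[B] (Pmod B ι e i ⧸ N) := (radOf B (Pmod B ι e j)).liftQ g hrad.le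
  have hfinj : Function.Injective f := by
    rw [← LinearMap.ker_eq_bot]
    exact Submodule.ker_liftQ_eq_bot _ _ _ hrad.ge
  let π : (Pmod B ι e i ⧸ N) →ₗ[B] Smod B ι e i := Submodule.factor hN.le
  have hπ : ∀ y : Pmod B ι e i, π (Submodule.Quotient.mk y) = Submodule.Quotient.mk y :=
    fun y => rfl
  have hπs : Function.Surjective π := Submodule.factor_surjective hN.le
  have hex : Function.Exact f π := by
    intro y
    obtain ⟨y, rfl⟩ := Submodule.Quotient.mk_surjective _ y
    rw [hπ, Submodule.Quotient.mk_eq_zero]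
    constructor
    · intro hy
      rw [← hcov ⊤ (fun h => hgen (h trivial))] at hy
      obtain ⟨n, hn, _, ⟨κ, hκ, rfl⟩, rfl⟩ := Submodule.mem_sup.1 hy
      refine ⟨Submodule.Quotient.mk κ, ?_⟩
      change Submodule.Quotient.mk (rmul j x κ) = _
      rw [eq_comm, Submodule.Quotient.eq]
      simpa using hn
    · rintro ⟨z, hz⟩
      obtain ⟨z, rfl⟩ := Submodule.Quotient.mk_surjective _ z
      change Submodule.Quotient.mk (rmul j x z) = _ at hz
      rw [eq_comm, Submodule.Quotient.eq] at hz
      have h1 := Submodule.add_mem _ (hN.le hz) (Submodule.smul_mem _ (z : B) hxr)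
      rw [← rmul_apply] at h1
      simpa using h1
  let S : ShortComplex (ModuleCat.{0} B) :=
    ShortComplex.mk (X₁ := SmodCat B ι e j) (X₂ := ModuleCat.of B (Pmod B ι e i ⧸ N))
      (X₃ := SmodCat B ι e i) (ModuleCat.ofHom f) (ModuleCat.ofHom π) (by
        ext z
        exact hex.apply_apply_eq_zero (Submodule.Quotient.mk z))
  have hS : S.ShortExact := ModuleCat.shortComplex_shortExact S hex hfinj hπs
  by_contra hcon
  obtain ⟨s, hs⟩ := split_of_ext (k' := k) S hS hcon
  have hs' : ∀ z : Smod B ι e i, π (s.hom z) = z := fun z =>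
    congrArg (fun t : SmodCat B ι e i ⟶ SmodCat B ι e i => t.hom z) hs
  let s' : Smod B ι e i →ₗ[B] (Pmod B ι e i ⧸ N) := s.hom
  change ∀ z : Smod B ι e i, π (s' z) = z at hs'
  obtain ⟨y, hy⟩ := Submodule.Quotient.mk_surjective _ (s' (Submodule.Quotient.mk (gen hI i)))
  have hyr : y - gen hI i ∈ radOf B (Pmod B ι e i) := by
    rw [← Submodule.Quotient.eq, ← hπ, hy, hs']
  have hspan : Submodule.span B {y} = ⊤ := by
    by_contra hne
    have hyy := le_rad hI i _ hne (Submodule.mem_span_singleton_self y)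
    apply (isCoatom_rad hI i).1
    apply eq_top_of_gen_mem hI
    have := Submodule.sub_mem _ hyy hyr
    simpa using this
  apply hN.lt.not_ge
  intro r hr
  have : r ∈ Submodule.span B {y} := by rw [hspan]; trivial
  obtain ⟨b, rfl⟩ := Submodule.mem_span_singleton.1 this
  have h1 : b • (Submodule.Quotient.mk (gen hI i) : Smod B ι e i) = 0 := by
    rw [← hs' (Submodule.Quotient.mk (gen hI i)), ← map_smul, ← hy, ← Submodule.Quotient.mk_smul,
      hπ, Submodule.Quotient.mk_eq_zero]
    exact hr
  rw [← Submodule.Quotient.mk_eq_zero, Submodule.Quotient.mk_smul, hy, ← map_smul, h1, map_zero]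

lemma schur_aux (M : Type) [AddCommGroup M] [Module B M] [Module k M] [IsScalarTower k B M]
    [Module.Finite B M] (R : Submodule B M) (hR : IsCoatom R) :
    Nonempty (Module.End B (M ⧸ R) ≃+* k) := by
  have : IsSimpleModule B (M ⧸ R) := isSimpleModule_iff_isCoatom.2 hR
  have : FiniteDimensional k (M ⧸ R) := Module.Finite.trans B (M ⧸ R)
  exact ⟨(RingEquiv.ofBijective (algebraMap k (Module.End B (M ⧸ R)))
    (IsSimpleModule.algebraMap_end_bijective_of_isAlgClosed k)).symm⟩

lemma end_equiv (hI : IsCompletePrimitiveIdem B ι e) (i : ι)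
    (hR : IsCoatom (radOf B (Pmod B ι e i))) :
    Nonempty ((Module.End B (Smod B ι e i)) ≃+* k) := by
  have : IsNoetherianRing B := IsNoetherianRing.of_finite k B
  exact schur_aux k (Pmod B ι e i) _ hR

end Aux

/-- Let `B` be a directed basic finite-dimensional `k`-algebra with
precedence partial order `⪯` on the index set `ι` of its complete family of primitive
orthogonal idempotents.  Then for each `i` the trace `T i` of the projectives `P j`
with `j ⋠ i` in `P i` equals `rad (P i)`; hence the `i`-th standard module
`Δ i = P i / T i` (relative to `(ι, ⪯)`) is isomorphic to the simple module `S i`,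
and `End_B (S i) ≅ k`. -/
theorem statement5 (hIdem : IsCompletePrimitiveIdem B ι e)
    (hBasic : ∀ i j, i ≠ j → IsEmpty ((↥(Pmod B ι e i)) ≃ₗ[B] ↥(Pmod B ι e j)))
    (hDirected : ∀ i, ¬ prec k B ι e i i) :
    ∀ i : ι,
      traceSub k B ι e i = radOf B ↥(Pmod B ι e i) ∧
      Nonempty ((↥(Pmod B ι e i) ⧸ traceSub k B ι e i) ≃ₗ[B] Smod B ι e i) ∧
      Nonempty ((Module.End B (Smod B ι e i)) ≃+* k) := by
  have hFin : Module.Finite k B := inferInstance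
  have hA : IsArtinianRing B := IsArtinianRing.of_finite k B
  have hNoe : IsNoetherianRing B := IsNoetherianRing.of_finite k B
  intro i
  have hT : traceSub k B ι e i = radOf B ↥(Pmod B ι e i) := by
    have hle : traceSub k B ι e i ≤ radOf B ↥(Pmod B ι e i) := by
      refine iSup_le fun j => iSup_le fun hj => iSup_le fun f => ?_
      exact range_le_rad hIdem i j (hBasic j i fun h => hj (Or.inl h)) f
    by_contra hne
    obtain ⟨N, hTN, hN⟩ := exists_le_covBy_of_lt (lt_of_le_of_ne hle hne)
    obtain ⟨x, hxr, hxN⟩ := SetLike.exists_of_lt hN.lt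
    have : ∃ j, e j • x ∉ N := by
      by_contra hall
      push Not at hall
      apply hxN
      rw [← one_smul B x, ← hIdem.sum_eq_one, Finset.sum_smul]
      exact N.sum_mem fun j _ => hall j
    obtain ⟨j, hj⟩ := this
    have hp := prec0_of_covBy k hIdem i j N hN x hxr hj
    have hnot : ¬ preceq k B ι e j i := by
      rintro (h | h)
      · subst h
        exact hDirected _ (Relation.TransGen.single hp)
      · exact hDirected i (Relation.TransGen.head hp h)
    apply hj
    apply hTN
    have h1 : LinearMap.range (rmul j x) ≤ traceSub k B ι e i :=
      le_iSup_of_le j (le_iSup_of_le hnot (le_iSup_of_le (rmul j x) le_rfl))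
    exact h1 ⟨gen hIdem j, rfl⟩
  refine ⟨hT, ⟨Submodule.quotEquivOfEq _ _ hT⟩, ?_⟩
  exact end_equiv k hIdem i (isCoatom_rad hIdem i)

end
end
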